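/- For all natural numbers a, b and positive integers s, t with −t ≤ b − a ≤ s, the number of ±1 walks of length a+b from 0 to b−a that stay strictly between −t and s (equivalently, monotone N/E lattice paths from (0,0) to (a,b) that never touch the lines y = x + s and y = x − t) equals Σ_{z ∈ ℤ} [ C(a+b, b + z(s+t)) − C(a+b, b + z(s+t) + t) ], where only finitely many terms are nonzero; in particular, when b − a = s or b − a = −t this sum equals 0. -/

import Mathlib

/-- `IsStrictBandWalk s t n d f` : `f` is a ±1 walk of length `n` from `0` to `d`
staying strictly between `-t` and `s`. -/
def IsStrictBandWalk (s t : ℤ) (n : ℕ) (d : ℤ) (f : Fin (n + 1) → ℤ) : Prop :=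
  f 0 = 0 ∧ f (Fin.last n) = d ∧
    (∀ u : Fin n, |f u.succ - f u.castSucc| = 1) ∧
    ∀ u, -t < f u ∧ f u < s

/-- `M a b s t` : the number of ±1 walks of length `a + b` from `0` to `b - a`
staying strictly between `-t` and `s` (equivalently, monotone N/E lattice paths from
`(0,0)` to `(a,b)` avoiding the lines `y = x + s` and `y = x - t`). -/
noncomputable def M (a b : ℕ) (s t : ℤ) : ℕ :=
  Nat.card {f : Fin (a + b + 1) → ℤ // IsStrictBandWalk s t (a + b) ((b : ℤ) - a) f}

/-- Binomial coefficient with an integer lower index: `0` when the lower index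
is negative (and, via `Nat.choose`, when it exceeds `n`). -/
def binom (n : ℕ) (m : ℤ) : ℕ := if 0 ≤ m then n.choose m.toNat else 0

theorem finite_setOf_isStrictBandWalk (s t : ℤ) (n : ℕ) (d : ℤ) :
    {f | IsStrictBandWalk s t n d f}.Finite :=
  (Set.Finite.pi' fun _ => Set.finite_Ioo (-t) s).subset fun _ hf u => hf.2.2.2 u

theorem IsStrictBandWalk.end_mem {s t : ℤ} {n : ℕ} {d : ℤ} {f : Fin (n + 1) → ℤ}
    (hf : IsStrictBandWalk s t n d f) : -t < d ∧ d < s :=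
  hf.2.1 ▸ hf.2.2.2 (Fin.last n)

/-- A walk of length `n + 1` is a walk of length `n` followed by one step. -/
theorem isStrictBandWalk_snoc {s t : ℤ} {n : ℕ} {d : ℤ} (hd : -t < d ∧ d < s)
    (g : Fin (n + 1) → ℤ) :
    IsStrictBandWalk s t (n + 1) d (Fin.snoc g d : Fin (n + 2) → ℤ) ↔
      IsStrictBandWalk s t n (d - 1) g ∨ IsStrictBandWalk s t n (d + 1) g := by
  have h0 : (Fin.snoc g d : Fin (n + 2) → ℤ) 0 = g 0 :=
    Fin.snoc_castSucc (α := fun _ => ℤ) d g 0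
  have hstep : |d - g (Fin.last n)| = 1 ↔ g (Fin.last n) = d - 1 ∨ g (Fin.last n) = d + 1 := by
    rw [abs_eq zero_le_one]; omega
  have hpred (u : Fin n) : (Fin.snoc g d : Fin (n + 2) → ℤ) u.castSucc.succ = g u.succ := by
    rw [Fin.succ_castSucc]; exact Fin.snoc_castSucc (α := fun _ => ℤ) d g u.succ
  unfold IsStrictBandWalk
  rw [Fin.forall_fin_succ', Fin.forall_fin_succ' (P := fun u => -t < _ ∧ _ < s)]
  simp only [h0, hpred, Fin.snoc_castSucc, Fin.snoc_last, Fin.succ_last, hstep]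
  tauto

theorem ncard_isStrictBandWalk_succ {s t : ℤ} (n : ℕ) {d : ℤ} (hd : -t < d ∧ d < s) :
    {f | IsStrictBandWalk s t (n + 1) d f}.ncard =
      {f | IsStrictBandWalk s t n (d - 1) f}.ncard +
        {f | IsStrictBandWalk s t n (d + 1) f}.ncard := by
  have himage : {f | IsStrictBandWalk s t (n + 1) d f} =
      (fun g => (Fin.snoc g d : Fin (n + 2) → ℤ)) ''
        ({f | IsStrictBandWalk s t n (d - 1) f} ∪ {f | IsStrictBandWalk s t n (d + 1) f}) := by
    ext f
    constructor
    · intro hf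
      have hsnoc : (Fin.snoc (Fin.init f) d : Fin (n + 2) → ℤ) = f := by
        conv_rhs => rw [← Fin.snoc_init_self f, hf.2.1]
      exact ⟨Fin.init f, (isStrictBandWalk_snoc hd _).1 (hsnoc.symm ▸ hf), hsnoc⟩
    · rintro ⟨g, hg, rfl⟩
      exact (isStrictBandWalk_snoc hd g).2 hg
  have hinj : Function.Injective (fun g : Fin (n + 1) → ℤ => (Fin.snoc g d : Fin (n + 2) → ℤ)) :=
    fun g g' h => (Fin.snoc_injective2 h).1
  rw [himage, Set.ncard_image_of_injective _ hinj,
    Set.ncard_union_eq _ (finite_setOf_isStrictBandWalk ..) (finite_setOf_isStrictBandWalk ..)]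
  refine Set.disjoint_left.2 fun g hg hg' => ?_
  have := hg.2.1.symm.trans hg'.2.1
  omega

theorem ncard_isStrictBandWalk_zero {s t : ℤ} (hs : 0 < s) (ht : 0 < t) (d : ℤ) :
    {f | IsStrictBandWalk s t 0 d f}.ncard = if d = 0 then 1 else 0 := by
  split_ifs with hd
  · rw [Set.ncard_eq_one]
    refine ⟨0, Set.ext fun f => ⟨fun hf => ?_, ?_⟩⟩
    · ext u
      rw [Fin.fin_one_eq_zero u]
      exact hf.1
    · rintro rfl
      exact ⟨rfl, hd.symm, fun u => u.elim0, fun _ => ⟨neg_lt_zero.2 ht, hs⟩⟩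
  · rw [Set.ncard_eq_zero (finite_setOf_isStrictBandWalk ..)]
    exact Set.eq_empty_of_forall_notMem fun f hf => hd (hf.2.1.symm.trans hf.1)

theorem ncard_isStrictBandWalk_eq_zero {s t : ℤ} (n : ℕ) {d : ℤ} (hd : ¬(-t < d ∧ d < s)) :
    {f | IsStrictBandWalk s t n d f}.ncard = 0 := by
  rw [Set.ncard_eq_zero (finite_setOf_isStrictBandWalk ..)]
  exact Set.eq_empty_of_forall_notMem fun f hf => hd hf.end_mem

theorem binom_eq_zero {n : ℕ} {m : ℤ} (h : m < 0 ∨ n < m) : binom n m = 0 := by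
  unfold binom
  split_ifs
  · exact Nat.choose_eq_zero_of_lt (by omega)
  · rfl

theorem binom_natCast (n m : ℕ) : binom n m = n.choose m := by
  simp [binom]

theorem binom_zero (m : ℤ) : binom 0 m = if m = 0 then 1 else 0 := by
  split_ifs with h
  · simp [h, binom]
  · exact binom_eq_zero (by omega)

theorem binom_succ (n : ℕ) (m : ℤ) : binom (n + 1) m = binom n (m - 1) + binom n m := by
  obtain hm | rfl | hm := lt_trichotomy m 0
  · rw [binom_eq_zero (.inl hm), binom_eq_zero (.inl hm), binom_eq_zero (.inl (by omega))]
  · simp [binom]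
  · obtain ⟨k, rfl⟩ : ∃ k : ℕ, m = (k + 1 : ℕ) := ⟨(m - 1).toNat, by omega⟩
    rw [show ((k + 1 : ℕ) : ℤ) - 1 = k by omega]
    simp only [binom_natCast, Nat.choose_succ_succ']

theorem binom_symm (n : ℕ) (m : ℤ) : binom n (n - m) = binom n m := by
  by_cases h : m < 0 ∨ n < m
  · rw [binom_eq_zero h, binom_eq_zero (by omega)]
  · lift m to ℕ using by omega
    have hmn : m ≤ n := by omega
    rw [← Nat.cast_sub hmn, binom_natCast, binom_natCast, Nat.choose_symm hmn]

/-- The sum of the binomial coefficients of `n` over the residue class of `m` modulo `k`. -/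
noncomputable def residueBinomSum (k : ℤ) (n : ℕ) (m : ℤ) : ℤ :=
  ∑ᶠ z : ℤ, (binom n (m + z * k) : ℤ)

theorem finite_support_binom {k : ℤ} (hk : 0 < k) (n : ℕ) (m : ℤ) :
    (Function.support fun z : ℤ => (binom n (m + z * k) : ℤ)).Finite := by
  have hinj : Function.Injective fun z : ℤ => m + z * k :=
    fun x y h => mul_right_cancel₀ hk.ne' (add_left_cancel h)
  refine ((Set.finite_Icc (0 : ℤ) n).preimage hinj.injOn).subset fun z hz => ?_
  by_contra h
  refine hz (Nat.cast_eq_zero.2 (binom_eq_zero ?_))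
  simp only [Set.mem_preimage, Set.mem_Icc] at h
  omega

theorem residueBinomSum_succ {k : ℤ} (hk : 0 < k) (n : ℕ) (m : ℤ) :
    residueBinomSum k (n + 1) m = residueBinomSum k n (m - 1) + residueBinomSum k n m := by
  unfold residueBinomSum
  rw [← finsum_add_distrib (finite_support_binom hk ..) (finite_support_binom hk ..)]
  refine finsum_congr fun z => ?_
  rw [binom_succ, Nat.cast_add, add_sub_right_comm]

theorem residueBinomSum_eq_of_add_eq {k : ℤ} {n : ℕ} {m m' c : ℤ} (h : m + m' = n + c * k) :
    residueBinomSum k n m = residueBinomSum k n m' := by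
  unfold residueBinomSum
  rw [← finsum_comp_equiv (Equiv.subLeft (-c))]
  refine finsum_congr fun z => ?_
  rw [← binom_symm, Equiv.subLeft_apply]
  congr 2
  linear_combination -h

theorem residueBinomSum_zero_self {k : ℤ} (hk : 0 < k) : residueBinomSum k 0 0 = 1 := by
  unfold residueBinomSum
  rw [finsum_eq_single _ 0]
  · simp [binom]
  · intro z hz
    simp [binom_zero, hz, hk.ne']

theorem residueBinomSum_zero_of_not_dvd {k m : ℤ} (h : ¬k ∣ m) : residueBinomSum k 0 m = 0 := by
  unfold residueBinomSum
  refine finsum_eq_zero_of_forall_eq_zero fun z => ?_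
  rw [binom_zero, if_neg fun hz => h ⟨-z, by linear_combination hz⟩, Nat.cast_zero]

/-- By symmetry of the binomial coefficients, the reflection sum vanishes on both barriers. -/
theorem residueBinomSum_eq_of_barrier {s t : ℤ} {n : ℕ} {m : ℤ}
    (h : 2 * m - n = s ∨ 2 * m - n = -t) :
    residueBinomSum (s + t) n m = residueBinomSum (s + t) n (m + t) := by
  obtain h | h := h
  · exact residueBinomSum_eq_of_add_eq (c := 1) (by linear_combination h)
  · exact residueBinomSum_eq_of_add_eq (c := 0) (by linear_combination h)

theorem ncard_isStrictBandWalk {s t : ℤ} (hs : 0 < s) (ht : 0 < t) (n : ℕ) (m : ℤ)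
    (h₁ : -t ≤ 2 * m - n) (h₂ : 2 * m - n ≤ s) :
    ({f | IsStrictBandWalk s t n (2 * m - n) f}.ncard : ℤ) =
      residueBinomSum (s + t) n m - residueBinomSum (s + t) n (m + t) := by
  have hk : 0 < s + t := add_pos hs ht
  induction n generalizing m with
  | zero =>
    have hmt : ¬(s + t) ∣ m + t := fun hdvd =>
      absurd (Int.le_of_dvd (by omega) hdvd) (by omega)
    rw [ncard_isStrictBandWalk_zero hs ht, residueBinomSum_zero_of_not_dvd hmt]
    by_cases hm : m = 0
    · simp [hm, residueBinomSum_zero_self hk]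
    · have hdvd : ¬(s + t) ∣ m := fun hdvd =>
        absurd (Int.eq_zero_of_abs_lt_dvd hdvd (abs_lt.2 (by omega))) hm
      simp [hm, residueBinomSum_zero_of_not_dvd hdvd]
  | succ n ih =>
    by_cases hd : -t < 2 * m - (n + 1 : ℕ) ∧ 2 * m - (n + 1 : ℕ) < s
    · rw [ncard_isStrictBandWalk_succ n hd,
        show 2 * m - ((n + 1 : ℕ) : ℤ) - 1 = 2 * (m - 1) - n by omega,
        show 2 * m - ((n + 1 : ℕ) : ℤ) + 1 = 2 * m - n by omega,
        Nat.cast_add, ih (m - 1) (by omega) (by omega), ih m (by omega) (by omega),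
        residueBinomSum_succ hk, residueBinomSum_succ hk, add_sub_right_comm m]
      ring
    · rw [ncard_isStrictBandWalk_eq_zero _ hd, residueBinomSum_eq_of_barrier (by omega)]
      simp

/-- **Reflection enumeration (Mohanty).** For `s, t > 0` with `-t ≤ b - a ≤ s`,
`M(a,b,s,t) = Σ_{z ∈ ℤ} [C(a+b, b + z(s+t)) - C(a+b, b + z(s+t) + t)]`;
in particular, when `b - a = s` or `b - a = -t` this sum equals `0`. -/
theorem strict_band_count (a b : ℕ) (s t : ℤ) (hs : 0 < s) (ht : 0 < t)
    (h₁ : -t ≤ (b : ℤ) - a) (h₂ : (b : ℤ) - a ≤ s) :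
    (M a b s t : ℤ) =
        (∑ᶠ z : ℤ, ((binom (a + b) ((b : ℤ) + z * (s + t)) : ℤ) -
          (binom (a + b) ((b : ℤ) + z * (s + t) + t) : ℤ))) ∧
      (((b : ℤ) - a = s ∨ (b : ℤ) - a = -t) →
        (∑ᶠ z : ℤ, ((binom (a + b) ((b : ℤ) + z * (s + t)) : ℤ) -
          (binom (a + b) ((b : ℤ) + z * (s + t) + t) : ℤ))) = 0) := by
  have hk : 0 < s + t := add_pos hs ht
  have hsum : (∑ᶠ z : ℤ, ((binom (a + b) ((b : ℤ) + z * (s + t)) : ℤ) -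
      (binom (a + b) ((b : ℤ) + z * (s + t) + t) : ℤ))) =
      residueBinomSum (s + t) (a + b) b - residueBinomSum (s + t) (a + b) (b + t) := by
    simp only [add_right_comm (b : ℤ) _ t]
    exact finsum_sub_distrib (finite_support_binom hk ..) (finite_support_binom hk ..)
  have hd : (b : ℤ) - a = 2 * b - (a + b : ℕ) := by omega
  rw [hsum]
  refine ⟨?_, fun h => ?_⟩
  · rw [← ncard_isStrictBandWalk hs ht _ _ (hd ▸ h₁) (hd ▸ h₂), ← hd]
    rfl
  · rw [residueBinomSum_eq_of_barrier (hd ▸ h), sub_self]
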